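/- Let X be a d-dimensional real Banach space and P_1,...,P_n continuous polynomials on X of degrees k_1,...,k_n. Then ‖P_1‖⋯‖P_n‖ ≤ ((4ed)^{k_1+⋯+k_n} / 2^n) ‖P_1⋯P_n‖, where ‖Q‖ = sup over the unit ball of |Q|. -/

import Mathlib

/-- `P : X → ℝ` is a continuous polynomial of degree at most `k`:
a sum of continuous `l`-homogeneous terms for `l = 0, …, k`. -/
def IsPolyDegLE {X : Type*} [NormedAddCommGroup X] [NormedSpace ℝ X]
    (P : X → ℝ) (k : ℕ) : Prop :=
  ∃ M : (l : Fin (k + 1)) → ContinuousMultilinearMap ℝ (fun _ : Fin l => X) ℝ,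
    ∀ z, P z = ∑ l, M l (fun _ => z)

/-- The sup norm of a scalar function over the closed unit ball. -/
noncomputable def supNorm {X : Type*} [NormedAddCommGroup X] [NormedSpace ℝ X]
    (P : X → ℝ) : ℝ :=
  ⨆ z ∈ Metric.closedBall (0 : X) 1, |P z|

open MeasureTheory Set Metric
open scoped ENNReal

/-- The function `x ↦ -log |x|`, truncated below at `0` and equal to `∞` at `x = 0`. -/
noncomputable def negLog (x : ℝ) : ℝ≥0∞ :=
  if x = 0 then ∞ else ENNReal.ofReal (-Real.log x)

lemma measurable_negLog : Measurable negLog :=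
  Measurable.ite (measurableSet_singleton 0) measurable_const
    Real.measurable_log.neg.ennreal_ofReal

lemma negLog_mul_le (x y : ℝ) : negLog (x * y) ≤ negLog x + negLog y := by
  by_cases hx : x = 0
  · simp [negLog, hx]
  by_cases hy : y = 0
  · simp [negLog, hy]
  simp only [negLog, hx, hy, mul_eq_zero, or_self, if_false]
  rw [Real.log_mul hx hy, neg_add]
  exact ENNReal.ofReal_add_le

lemma negLog_prod_le {ι : Type*} (s : Finset ι) (f : ι → ℝ) :
    negLog (∏ i ∈ s, f i) ≤ ∑ i ∈ s, negLog (f i) := by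
  induction s using Finset.cons_induction with
  | empty => simp [negLog]
  | cons i s hi ih =>
    rw [Finset.prod_cons, Finset.sum_cons]
    exact (negLog_mul_le _ _).trans (by gcongr)

lemma exp_neg_le_of_negLog_le {x : ℝ} {c : ℝ} (hx : 0 ≤ x) (hc : 0 ≤ c)
    (h : negLog x ≤ ENNReal.ofReal c) : Real.exp (-c) ≤ x := by
  by_cases hx0 : x = 0
  · simp [negLog, hx0] at h
  rw [negLog, if_neg hx0, ENNReal.ofReal_le_ofReal_iff hc] at h
  rw [← Real.le_log_iff_exp_le (lt_of_le_of_ne hx (Ne.symm hx0))]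
  linarith

lemma lintegral_negLog_le {α : Type*} [MeasurableSpace α] (ν : Measure α) [IsFiniteMeasure ν]
    {g : α → ℝ} (hg : Measurable g) (hg0 : ∀ x, 0 ≤ g x) {D : ℝ} (hD : 1 ≤ D)
    (h : ∀ t, 0 < t → ν {x | g x ≤ t} ≤ ENNReal.ofReal (D * t) * ν univ) :
    ∫⁻ x, negLog (g x) ∂ν ≤ ENNReal.ofReal (1 + Real.log D) * ν univ := by
  have hD0 : 0 < D := by linarith
  have hlogD : 0 ≤ Real.log D := Real.log_nonneg hD
  have hzero : ν {x | g x = 0} = 0 := by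
    have hlim : Filter.Tendsto (fun t : ℝ => ENNReal.ofReal (D * t) * ν univ)
        (nhdsWithin 0 (Ioi 0)) (nhds 0) := by
      have h1 : Filter.Tendsto (fun t : ℝ => ENNReal.ofReal (D * t))
          (nhdsWithin 0 (Ioi 0)) (nhds 0) := by
        have : Continuous fun t : ℝ => ENNReal.ofReal (D * t) :=
          ENNReal.continuous_ofReal.comp (by fun_prop)
        simpa using (this.tendsto 0).mono_left nhdsWithin_le_nhds
      simpa using ENNReal.Tendsto.mul_const h1 (Or.inr (measure_ne_top ν univ))
    refine le_antisymm (ge_of_tendsto hlim ?_) zero_le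
    filter_upwards [self_mem_nhdsWithin] with t ht
    exact (measure_mono fun x (hx : g x = 0) => by simpa [hx] using (mem_Ioi.1 ht).le).trans (h t ht)
  have hne : ∀ᵐ x ∂ν, g x ≠ 0 := by
    rw [ae_iff]
    simpa using hzero
  calc ∫⁻ x, negLog (g x) ∂ν = ∫⁻ x, ENNReal.ofReal (max 0 (-Real.log (g x))) ∂ν := by
        refine lintegral_congr_ae (hne.mono fun x hx => ?_)
        simp [negLog, hx, ENNReal.ofReal_max]
    _ = ∫⁻ t in Ioi 0, ν {x | t ≤ max 0 (-Real.log (g x))} :=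
        lintegral_eq_lintegral_meas_le ν (Filter.Eventually.of_forall fun x => le_max_left _ _)
          (measurable_const.max (Real.measurable_log.comp hg).neg).aemeasurable
    _ ≤ ∫⁻ t in Ioc 0 (Real.log D) ∪ Ioi (Real.log D),
          ν {x | t ≤ max 0 (-Real.log (g x))} := by
        rw [Ioc_union_Ioi_eq_Ioi hlogD]
    _ ≤ (∫⁻ t in Ioc 0 (Real.log D), ν {x | t ≤ max 0 (-Real.log (g x))}) +
          ∫⁻ t in Ioi (Real.log D), ν {x | t ≤ max 0 (-Real.log (g x))} :=
        lintegral_union_le _ _ _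
    _ ≤ (∫⁻ _ in Ioc 0 (Real.log D), ν univ) +
          ∫⁻ t in Ioi (Real.log D), ENNReal.ofReal (D * Real.exp (-t)) * ν univ := by
        refine add_le_add (lintegral_mono fun t => measure_mono (subset_univ _))
          (setLIntegral_mono (by fun_prop) fun t ht => ?_)
        refine (measure_mono fun x hx => ?_).trans (h _ (Real.exp_pos _))
        have ht0 : 0 < t := hlogD.trans_lt ht
        have hx' : t ≤ -Real.log (g x) := (le_max_iff.1 hx).resolve_left (not_le.2 ht0)
        rcases (hg0 x).eq_or_lt with h0 | h0
        · simpa [← h0] using (Real.exp_pos (-t)).le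
        · exact (Real.log_le_iff_le_exp h0).1 (by linarith)
    _ = ENNReal.ofReal (1 + Real.log D) * ν univ := by
        have hexp : ∫⁻ t in Ioi (Real.log D), ENNReal.ofReal (D * Real.exp (-t)) = 1 := by
          rw [← ofReal_integral_eq_lintegral_ofReal
            ((integrableOn_exp_neg_Ioi _).const_mul D)
            (Filter.Eventually.of_forall fun t => by positivity),
            integral_const_mul, integral_exp_neg_Ioi, Real.exp_neg, Real.exp_log hD0,
            mul_inv_cancel₀ hD0.ne', ENNReal.ofReal_one]
        rw [lintegral_mul_const _ (by fun_prop), hexp, setLIntegral_const, Real.volume_Ioc,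
          sub_zero, ENNReal.ofReal_add zero_le_one hlogD, ENNReal.ofReal_one, mul_comm, add_mul,
          add_comm, one_mul]

open Measure in
lemma volumeIoiPow_restrict_apply_le (m : ℕ) (L : Ioi (0 : ℝ)) {s : Set (Ioi (0 : ℝ))}
    (hs : MeasurableSet s) {c δ : ℝ} (hδ : 0 ≤ δ) (h : ∀ r ∈ s, r < L → |(r : ℝ) - c| ≤ δ * L) :
    (volumeIoiPow m).restrict (Iio L) s ≤
      ENNReal.ofReal (2 * (m + 1) * δ) * (volumeIoiPow m).restrict (Iio L) univ := by
  have hL : 0 < (L : ℝ) := L.2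
  rw [restrict_apply hs, restrict_apply_univ, volumeIoiPow_apply_Iio, volumeIoiPow,
    withDensity_apply _ (hs.inter measurableSet_Iio)]
  calc ∫⁻ r in s ∩ Iio L, ENNReal.ofReal ((r : ℝ) ^ m) ∂(volume.comap Subtype.val)
      ≤ ∫⁻ _ in s ∩ Iio L, ENNReal.ofReal ((L : ℝ) ^ m) ∂(volume.comap Subtype.val) := by
        refine setLIntegral_mono measurable_const fun r hr => ENNReal.ofReal_le_ofReal ?_
        exact pow_le_pow_left₀ (le_of_lt r.2) (le_of_lt hr.2) m
    _ = ENNReal.ofReal ((L : ℝ) ^ m) * volume (Subtype.val '' (s ∩ Iio L)) := by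
        rw [setLIntegral_const, comap_subtype_coe_apply measurableSet_Ioi]
    _ ≤ ENNReal.ofReal ((L : ℝ) ^ m) * volume (Icc (c - δ * L) (c + δ * L)) := by
        gcongr
        rintro _ ⟨r, ⟨hr, hrL⟩, rfl⟩
        have := abs_le.1 (h r hr hrL)
        constructor <;> linarith
    _ = ENNReal.ofReal (2 * (m + 1) * δ) * ENNReal.ofReal ((L : ℝ) ^ (m + 1) / (m + 1)) := by
        rw [Real.volume_Icc, ← ENNReal.ofReal_mul (by positivity),
          ← ENNReal.ofReal_mul (by positivity)]
        congr 1
        field_simp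
        ring

lemma isFiniteMeasure_volumeIoiPow_restrict (m : ℕ) (L : Ioi (0 : ℝ)) :
    IsFiniteMeasure ((Measure.volumeIoiPow m).restrict (Iio L)) :=
  ⟨by simp [Measure.volumeIoiPow_apply_Iio]⟩

lemma lintegral_negLog_linear_le (m : ℕ) (L : Ioi (0 : ℝ)) {a : ℂ} (ha : a ≠ 0) :
    ∫⁻ r, negLog (‖(r : ℂ) - a‖ / ‖a‖) ∂((Measure.volumeIoiPow m).restrict (Iio L)) ≤
      ENNReal.ofReal (1 + Real.log (2 * (m + 1))) *
        (Measure.volumeIoiPow m).restrict (Iio L) univ := by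
  have := isFiniteMeasure_volumeIoiPow_restrict m L
  have ha' : 0 < ‖a‖ := norm_pos_iff.2 ha
  have hg : Measurable fun r : Ioi (0 : ℝ) => ‖((r : ℝ) : ℂ) - a‖ / ‖a‖ := by fun_prop
  refine lintegral_negLog_le _ hg (fun r => by positivity)
    (by have : (0 : ℝ) ≤ m := m.cast_nonneg
        linarith) fun t ht => ?_
  refine volumeIoiPow_restrict_apply_le m L (c := min ‖a‖ L)
    (measurableSet_le hg measurable_const) ht.le fun r hr hrL => ?_
  have hr0 : 0 < (r : ℝ) := r.2
  have hrL' : (r : ℝ) < L := hrL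
  have hr1 : ‖((r : ℝ) : ℂ) - a‖ ≤ t * ‖a‖ := (div_le_iff₀ ha').1 hr
  have hr2 : |(r : ℝ) - ‖a‖| ≤ ‖((r : ℝ) : ℂ) - a‖ := by
    simpa [abs_of_pos hr0] using abs_norm_sub_norm_le ((r : ℝ) : ℂ) a
  have hr3 := abs_le.1 (hr2.trans hr1)
  rcases le_total ‖a‖ (L : ℝ) with h | h
  · rw [min_eq_left h, abs_le]
    have : t * ‖a‖ ≤ t * L := by gcongr
    constructor <;> linarith
  · rw [min_eq_right h, abs_le]
    refine ⟨?_, by nlinarith⟩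
    rcases le_total t 1 with ht1 | ht1
    · nlinarith
    · nlinarith

open Polynomial in
lemma lintegral_negLog_polynomial_le (m : ℕ) (L : Ioi (0 : ℝ)) (k : ℕ) (q : ℂ[X])
    (hq : q.natDegree ≤ k) (hq0 : q.eval 0 ≠ 0) :
    ∫⁻ r : Ioi (0 : ℝ), negLog (‖q.eval ((r : ℝ) : ℂ)‖ / ‖q.eval 0‖)
        ∂((Measure.volumeIoiPow m).restrict (Iio L)) ≤
      k * (ENNReal.ofReal (1 + Real.log (2 * (m + 1))) *
        (Measure.volumeIoiPow m).restrict (Iio L) univ) := by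
  induction k generalizing q with
  | zero =>
    rw [eq_C_of_natDegree_eq_zero (Nat.le_zero.1 hq)] at hq0 ⊢
    simp only [eval_C] at hq0 ⊢
    simp [div_self (norm_ne_zero_iff.2 hq0), negLog]
  | succ k ih =>
    rcases hq.lt_or_eq with hlt | heq
    · refine (ih q (Nat.lt_succ_iff.1 hlt) hq0).trans ?_
      gcongr
      exact Nat.le_succ k
    obtain ⟨a, ha⟩ := Complex.exists_root
      (natDegree_pos_iff_degree_pos.1 (heq ▸ Nat.succ_pos k : 0 < q.natDegree))
    obtain ⟨p, rfl⟩ := dvd_iff_isRoot.2 ha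
    have hp : p ≠ 0 := by
      rintro rfl
      simp at hq0
    rw [natDegree_mul (X_sub_C_ne_zero a) hp, natDegree_X_sub_C] at heq
    simp only [eval_mul, eval_sub, eval_X, eval_C, zero_sub, norm_mul, norm_neg] at hq0 ⊢
    have ha0 : a ≠ 0 := neg_ne_zero.1 (left_ne_zero_of_mul hq0)
    calc _ ≤ ∫⁻ r : Ioi (0 : ℝ), (negLog (‖((r : ℝ) : ℂ) - a‖ / ‖a‖) +
            negLog (‖p.eval ((r : ℝ) : ℂ)‖ / ‖p.eval 0‖))
            ∂((Measure.volumeIoiPow m).restrict (Iio L)) :=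
          lintegral_mono fun r => by
            rw [mul_div_mul_comm]
            exact negLog_mul_le _ _
      _ = _ := lintegral_add_left (measurable_negLog.comp (by fun_prop)) _
      _ ≤ _ := add_le_add (lintegral_negLog_linear_le m L ha0)
          (ih p (by omega) (right_ne_zero_of_mul hq0))
      _ = _ := by
          push_cast
          ring

lemma IsOpen.eq_empty_or_eq_Iio_of_isLowerSet {s : Set (Ioi (0 : ℝ))} (ho : IsOpen s)
    (hl : IsLowerSet s) (hb : BddAbove (Subtype.val '' s)) : s = ∅ ∨ ∃ L, s = Iio L := by
  refine s.eq_empty_or_nonempty.imp id fun ⟨x, hx⟩ => ?_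
  have hle : ∀ y ∈ s, (y : ℝ) ≤ sSup (Subtype.val '' s) := fun y hy =>
    le_csSup hb (mem_image_of_mem _ hy)
  refine ⟨⟨sSup (Subtype.val '' s), lt_of_lt_of_le x.2 (hle x hx)⟩, Set.ext fun y => ⟨fun hy => ?_,
    fun hy => ?_⟩⟩
  · obtain ⟨z, hyz, hz⟩ : ∃ z, y < z ∧ z ∈ s :=
      ((ho.eventually_mem hy).filter_mono nhdsWithin_le_nhds |>.and
        (self_mem_nhdsWithin : Ioi y ∈ nhdsWithin y (Ioi y))).exists.imp fun z hz => ⟨hz.2, hz.1⟩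
    exact lt_of_lt_of_le (show (y : ℝ) < z from hyz) (hle z hz)
  · obtain ⟨_, ⟨z, hz, rfl⟩, hyz⟩ := exists_lt_of_lt_csSup
      (Set.Nonempty.image Subtype.val ⟨x, hx⟩) (show (y : ℝ) < _ from hy)
    exact hl (le_of_lt (show y < z from hyz)) hz

section

variable {X : Type*} [NormedAddCommGroup X] [NormedSpace ℝ X]

lemma IsPolyDegLE.continuous {P : X → ℝ} {k : ℕ} (hP : IsPolyDegLE P k) : Continuous P := by
  obtain ⟨M, hM⟩ := hP
  rw [funext hM]
  exact continuous_finsetSum _ fun l _ => (M l).cont.comp (by fun_prop)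

open Polynomial in
lemma IsPolyDegLE.exists_polynomial {P : X → ℝ} {k : ℕ} (hP : IsPolyDegLE P k) (x u : X) :
    ∃ q : ℝ[X], q.natDegree ≤ k ∧ ∀ r : ℝ, q.eval r = P (x + r • u) := by
  obtain ⟨M, hM⟩ := hP
  refine ⟨∑ l : Fin (k + 1), ∑ s : Finset (Fin l),
    C (M l (s.piecewise (fun _ => u) fun _ => x)) * Polynomial.X ^ s.card, ?_, fun r => ?_⟩
  · refine natDegree_sum_le_of_forall_le _ _ fun l _ => natDegree_sum_le_of_forall_le _ _ fun s _ =>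
      (natDegree_C_mul_X_pow_le _ _).trans ?_
    exact (card_finset_fin_le s).trans (Nat.lt_succ_iff.1 l.2)
  · simp only [eval_finsetSum, eval_mul, eval_C, eval_pow, eval_X, hM]
    refine Finset.sum_congr rfl fun l _ => ?_
    have : (fun _ : Fin l => x + r • u) = (fun _ => r • u) + fun _ => x := by
      ext
      simp [add_comm]
    rw [this, (M l).map_add_univ]
    refine Finset.sum_congr rfl fun s _ => ?_
    have hs : s.piecewise (fun _ => r • u) (fun _ => x) =
        s.piecewise (fun i => r • s.piecewise (fun _ => u) (fun _ => x) i)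
          (s.piecewise (fun _ => u) fun _ => x) := by
      ext i
      by_cases hi : i ∈ s <;> simp [hi]
    rw [hs, (M l).map_piecewise_smul]
    simp [mul_comm]

lemma lintegral_eq_lintegral_toSphere [FiniteDimensional ℝ X] [MeasurableSpace X] [BorelSpace X]
    [Nontrivial X] (μ : Measure X) [μ.IsAddHaarMeasure] {F : X → ℝ≥0∞} (hF : Measurable F) :
    ∫⁻ y, F y ∂μ = ∫⁻ u : sphere (0 : X) 1, ∫⁻ r : Ioi (0 : ℝ), F ((r : ℝ) • (u : X))
      ∂(Measure.volumeIoiPow (Module.finrank ℝ X - 1)) ∂μ.toSphere := by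
  have hG : Measurable fun p : sphere (0 : X) 1 × Ioi (0 : ℝ) => F ((p.2 : ℝ) • (p.1 : X)) := by
    fun_prop
  rw [← lintegral_prod (fun p : sphere (0 : X) 1 × Ioi (0 : ℝ) => F ((p.2 : ℝ) • (p.1 : X)))
    hG.aemeasurable, ← μ.measurePreserving_homeomorphUnitSphereProd.lintegral_comp hG]
  conv_lhs => rw [← restrict_compl_singleton (μ := μ) 0,
    ← lintegral_subtype_comap (measurableSet_singleton _).compl]
  refine lintegral_congr fun y => ?_
  have hy : ‖(y : X)‖ ≠ 0 := norm_ne_zero_iff.2 y.2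
  simp [smul_smul, hy]

lemma IsPolyDegLE.lintegral_negLog_le [FiniteDimensional ℝ X] [MeasurableSpace X] [BorelSpace X]
    [Nontrivial X] (μ : Measure X) [μ.IsAddHaarMeasure] {P : X → ℝ} {k : ℕ}
    (hP : IsPolyDegLE P k) {x : X} (hx : x ∈ closedBall (0 : X) 1) (hPx : P x ≠ 0) :
    ∫⁻ z in ball (0 : X) 1, negLog (|P z| / |P x|) ∂μ ≤
      k * (ENNReal.ofReal (1 + Real.log (2 * Module.finrank ℝ X)) * μ (ball 0 1)) := by
  have hPm : Measurable P := hP.continuous.measurable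
  have hwm : Measurable fun z => negLog (|P z| / |P x|) :=
    measurable_negLog.comp (hPm.abs.div_const _)
  have hfin : ((Module.finrank ℝ X - 1 : ℕ) : ℝ) + 1 = Module.finrank ℝ X := by
    exact_mod_cast Nat.sub_add_cancel (Module.finrank_pos (R := ℝ) (M := X))
  have hpolar : ∀ {F : X → ℝ≥0∞}, Measurable F → ∫⁻ z in ball (0 : X) 1, F z ∂μ =
      ∫⁻ u : sphere (0 : X) 1, ∫⁻ r in {r : Ioi (0 : ℝ) | x + (r : ℝ) • (u : X) ∈ ball (0 : X) 1},
        F (x + (r : ℝ) • (u : X)) ∂(Measure.volumeIoiPow (Module.finrank ℝ X - 1))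
          ∂μ.toSphere := by
    intro F hF
    rw [← lintegral_indicator measurableSet_ball, ← lintegral_add_left_eq_self _ x,
      lintegral_eq_lintegral_toSphere μ (F := fun y => (ball (0 : X) 1).indicator F (x + y))
        ((hF.indicator measurableSet_ball).comp (measurable_const_add x))]
    refine lintegral_congr fun u => ?_
    have hs : MeasurableSet {r : Ioi (0 : ℝ) | x + (r : ℝ) • (u : X) ∈ ball (0 : X) 1} :=
      measurableSet_ball.preimage
        (by fun_prop : Measurable fun r : Ioi (0 : ℝ) => x + (r : ℝ) • (u : X))
    rw [← lintegral_indicator hs]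
    rfl
  rw [hpolar hwm, ← setLIntegral_one (μ := μ), hpolar measurable_const, ← lintegral_const_mul',
    ← lintegral_const_mul' _ _ (ENNReal.natCast_ne_top k)]
  · refine lintegral_mono fun u => ?_
    have hu : ‖(u : X)‖ = 1 := by simp
    set s := {r : Ioi (0 : ℝ) | x + (r : ℝ) • (u : X) ∈ ball (0 : X) 1} with hs
    rw [setLIntegral_one]
    have hopen : IsOpen s := isOpen_ball.preimage (by fun_prop)
    have hlower : IsLowerSet s := by
      intro r t htr hr
      have hr0 : (0 : ℝ) < r := r.2
      have ht0 : (0 : ℝ) < t := t.2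
      have := (convex_ball (0 : X) 1).add_smul_mem_interior' (x := x) (y := (r : ℝ) • (u : X))
        (by rwa [closure_ball _ one_ne_zero]) (by rwa [isOpen_ball.interior_eq])
        (t := (t : ℝ) / r) ⟨by positivity, (div_le_one hr0).2 htr⟩
      rwa [isOpen_ball.interior_eq, smul_smul, div_mul_cancel₀ _ hr0.ne'] at this
    have hbdd : BddAbove (Subtype.val '' s) := by
      refine ⟨2, ?_⟩
      rintro _ ⟨r, hr, rfl⟩
      have hr0 : (0 : ℝ) < r := r.2
      have h1 : ‖x + (r : ℝ) • (u : X)‖ < 1 := by simpa [hs] using hr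
      have h2 : ‖x‖ ≤ 1 := by simpa using hx
      have h3 := norm_sub_le (x + (r : ℝ) • (u : X)) x
      rw [add_sub_cancel_left, norm_smul, hu, Real.norm_of_nonneg hr0.le] at h3
      linarith
    rcases hopen.eq_empty_or_eq_Iio_of_isLowerSet hlower hbdd with h | ⟨L, h⟩
    · simp [h]
    · obtain ⟨q, hq, hqP⟩ := hP.exists_polynomial x (u : X)
      have heval : ∀ r : ℝ, ‖(q.map Complex.ofRealHom).eval (r : ℂ)‖ = |P (x + r • (u : X))| := by
        intro r
        rw [← hqP, ← Complex.ofRealHom_eq_coe, Polynomial.eval_map_apply]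
        simp
      have heval0 : ‖(q.map Complex.ofRealHom).eval 0‖ = |P x| := by simpa using heval 0
      have := lintegral_negLog_polynomial_le (Module.finrank ℝ X - 1) L k
        (q.map Complex.ofRealHom) (Polynomial.natDegree_map_le.trans hq)
        (norm_ne_zero_iff.1 (heval0 ▸ abs_ne_zero.2 hPx))
      simpa only [heval, heval0, hfin, Measure.restrict_apply_univ, ← h] using this
  · exact ENNReal.ofReal_ne_top

lemma Continuous.exists_supNorm_eq [FiniteDimensional ℝ X] {P : X → ℝ} (hP : Continuous P) :
    ∃ x ∈ closedBall (0 : X) 1, supNorm P = |P x| ∧ ∀ z ∈ closedBall (0 : X) 1, |P z| ≤ |P x| := by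
  have : ProperSpace X := FiniteDimensional.proper ℝ X
  obtain ⟨x, hx, hmax⟩ := (isCompact_closedBall (0 : X) 1).exists_isMaxOn
    (nonempty_closedBall.2 zero_le_one) hP.abs.continuousOn
  have hle : ∀ z, ⨆ _ : z ∈ closedBall (0 : X) 1, |P z| ≤ |P x| := fun z =>
    Real.iSup_le (fun hz => hmax hz) (abs_nonneg _)
  refine ⟨x, hx, le_antisymm (Real.iSup_le hle (abs_nonneg _)) ?_, fun z hz => hmax hz⟩
  refine le_ciSup_of_le ⟨|P x|, ?_⟩ x (ciSup_pos (f := fun _ => |P x|) hx).ge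
  rintro _ ⟨z, rfl⟩
  exact hle z

lemma Continuous.le_supNorm [FiniteDimensional ℝ X] {P : X → ℝ} (hP : Continuous P) {z : X}
    (hz : z ∈ closedBall (0 : X) 1) : |P z| ≤ supNorm P := by
  obtain ⟨x, -, hx, hmax⟩ := hP.exists_supNorm_eq
  exact hx ▸ hmax z hz

lemma supNorm_nonneg (P : X → ℝ) : 0 ≤ supNorm P :=
  Real.iSup_nonneg fun _ => Real.iSup_nonneg fun _ => abs_nonneg _

/-- Polynomials of degrees at most `k i` satisfy the product inequality with constant
`(2 * e * dim X) ^ ∑ i, k i`. -/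
lemma prod_supNorm_le [FiniteDimensional ℝ X] [Nontrivial X] {ι : Type*} [Fintype ι]
    {P : ι → X → ℝ} {k : ι → ℕ} (hP : ∀ i, IsPolyDegLE (P i) (k i)) :
    ∏ i, supNorm (P i) ≤
      (2 * Real.exp 1 * Module.finrank ℝ X) ^ (∑ i, k i) * supNorm (fun z => ∏ i, P i z) := by
  by_cases hzero : ∃ i, supNorm (P i) = 0
  · obtain ⟨i, hi⟩ := hzero
    rw [Finset.prod_eq_zero (Finset.mem_univ i) hi]
    exact mul_nonneg (by positivity) (supNorm_nonneg _)
  push Not at hzero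
  choose x hx hxP _ using fun i => (hP i).continuous.exists_supNorm_eq
  let : MeasurableSpace X := borel X
  have : BorelSpace X := ⟨rfl⟩
  let μ : Measure X := Measure.addHaar
  have hd : 1 ≤ (Module.finrank ℝ X : ℝ) := by exact_mod_cast Module.finrank_pos (R := ℝ) (M := X)
  set c : ℝ := 1 + Real.log (2 * Module.finrank ℝ X) with hc
  have hc0 : 0 ≤ c := by
    have := Real.log_nonneg (show (1 : ℝ) ≤ 2 * Module.finrank ℝ X by linarith)
    linarith
  have hmeas : ∀ i, Measurable fun z => negLog (|P i z| / |P i (x i)|) := fun i =>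
    measurable_negLog.comp ((hP i).continuous.measurable.abs.div_const _)
  have hμ0 : μ (ball 0 1) ≠ 0 := (measure_ball_pos μ 0 one_pos).ne'
  have hμ1 : μ (ball 0 1) ≠ ∞ := measure_ball_lt_top.ne
  obtain ⟨z, hz, hzle⟩ := exists_le_setLAverage hμ0 hμ1
    (Finset.measurable_sum Finset.univ fun i _ => hmeas i).aemeasurable
  have hsum : ∑ i, negLog (|P i z| / |P i (x i)|) ≤ ∑ i, ENNReal.ofReal (k i * c) := by
    rw [setLAverage_eq] at hzle
    refine hzle.trans (ENNReal.div_le_of_le_mul ?_)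
    rw [lintegral_finsetSum _ fun i _ => hmeas i, Finset.sum_mul]
    refine Finset.sum_le_sum fun i _ => ?_
    rw [ENNReal.ofReal_mul (Nat.cast_nonneg _), ENNReal.ofReal_natCast, mul_assoc]
    exact (hP i).lintegral_negLog_le μ (hx i)
      (abs_ne_zero.1 (hxP i ▸ hzero i))
  rw [← ENNReal.ofReal_sum_of_nonneg fun i _ => by positivity, ← Finset.sum_mul,
    ← Nat.cast_sum] at hsum
  have hexp := exp_neg_le_of_negLog_le (Finset.prod_nonneg fun i _ => by positivity)
    (by positivity) ((negLog_prod_le _ _).trans hsum)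
  have hN : 0 < ∏ i, |P i (x i)| :=
    Finset.prod_pos fun i _ => abs_pos.2 (abs_ne_zero.1 (hxP i ▸ hzero i))
  rw [Finset.prod_div_distrib, le_div_iff₀ hN, Real.exp_neg,
    inv_mul_le_iff₀ (Real.exp_pos _)] at hexp
  have hcexp : Real.exp ((∑ i, k i : ℕ) * c) =
      (2 * Real.exp 1 * Module.finrank ℝ X) ^ (∑ i, k i) := by
    rw [Real.exp_nat_mul, hc, Real.exp_add, Real.exp_log (by linarith)]
    ring
  have hcont : Continuous fun z => ∏ i, P i z :=
    continuous_finsetProd _ fun i _ => (hP i).continuous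
  calc ∏ i, supNorm (P i) = ∏ i, |P i (x i)| := Finset.prod_congr rfl fun i _ => hxP i
    _ ≤ _ := hexp
    _ ≤ _ := by
      rw [hcexp, ← Finset.abs_prod]
      gcongr
      exact hcont.le_supNorm (ball_subset_closedBall hz)

end

theorem prod_norm_le_real
    {X : Type*} [NormedAddCommGroup X] [NormedSpace ℝ X]
    [FiniteDimensional ℝ X] (d : ℕ) (hd : 0 < d)
    (hdim : Module.finrank ℝ X = d)
    (n : ℕ) (hn : 0 < n) (P : Fin n → X → ℝ) (k : Fin n → ℕ)
    (hk : ∀ i, 0 < k i) (hP : ∀ i, IsPolyDegLE (P i) (k i)) :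
    ∏ i, supNorm (P i) ≤
      ((4 * Real.exp 1 * d) ^ (∑ i, k i) / 2 ^ n) *
        supNorm (fun z => ∏ i, P i z) := by
  have : Nontrivial X := Module.nontrivial_of_finrank_pos (R := ℝ) (hdim ▸ hd)
  refine (prod_supNorm_le hP).trans (mul_le_mul_of_nonneg_right ?_ (supNorm_nonneg _))
  have hn' : n ≤ ∑ i, k i := by
    simpa using Finset.card_nsmul_le_sum Finset.univ k 1 fun i _ => hk i
  rw [le_div_iff₀ (by positivity), hdim]
  calc (2 * Real.exp 1 * (d : ℝ)) ^ (∑ i, k i) * 2 ^ n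
      ≤ (2 * Real.exp 1 * (d : ℝ)) ^ (∑ i, k i) * 2 ^ (∑ i, k i) := by
        gcongr
        norm_num
    _ = (4 * Real.exp 1 * d) ^ (∑ i, k i) := by
        rw [← mul_pow]
        ring
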